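/- arXiv:2004.00236 — 2 statements merged into one kernel-verified Lean document; each statement's English description precedes it below -/
import Mathlib

section
/- For every q > 2 there exists a constant C > 0, depending only on q, such that for every smooth compactly supported function f : ℝ² → ℝ one has ‖f‖_{L^∞(ℝ²)} ≤ C ‖∇f‖_{L²(ℝ²)} · ( ln( e + ‖f‖_{L^q(ℝ²)} + ‖∇f‖_{L^q(ℝ²)} ) )^{1/2} + C. -/
open MeasureTheory Set

noncomputable section

/-- The plane `ℝ²` as a Euclidean space. -/
abbrev E2 := EuclideanSpace ℝ (Fin 2)

/-- polar parametrisation -/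
def ePol (r θ : ℝ) : E2 := !₂[r * Real.cos θ, r * Real.sin θ]

lemma ePol_cont : Continuous (fun p : ℝ × ℝ => ePol p.1 p.2) := by
  unfold ePol
  refine (PiLp.continuous_toLp 2 _).comp ?_
  refine continuous_pi fun i => ?_
  fin_cases i <;> simp <;> fun_prop

lemma ePol_eq (r θ : ℝ) : ePol r θ = r • ePol 1 θ := by
  ext i; fin_cases i <;> simp [ePol]

lemma norm_ePol (r θ : ℝ) (hr : 0 ≤ r) : ‖ePol r θ‖ = r := by
  rw [EuclideanSpace.norm_eq]
  simp only [ePol, Fin.sum_univ_two]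
  simp only [Real.norm_eq_abs, sq_abs]
  have : (r * Real.cos θ)^2 + (r * Real.sin θ)^2 = r^2 := by
    have := Real.sin_sq_add_cos_sq θ
    linear_combination r^2 * this
  simp [this, Real.sqrt_sq hr]

lemma lintegral_polar (H : E2 → ENNReal) (hH : Measurable H) :
    ∫⁻ y, H y = ∫⁻ θ in Ioo (-Real.pi) Real.pi, ∫⁻ r in Ioi (0:ℝ),
      ENNReal.ofReal r * H (ePol r θ) := by
  have h1 : MeasurePreserving
      (fun p : ℝ × ℝ => (WithLp.toLp 2 ((MeasurableEquiv.finTwoArrow (α := ℝ)).symm p) : E2)) :=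
    (PiLp.volume_preserving_toLp (Fin 2)).comp
      (volume_preserving_finTwoArrow ℝ).symm
  rw [← h1.lintegral_comp hH, ← lintegral_comp_polarCoord_symm, polarCoord_target,
    Measure.volume_eq_prod, ← Measure.prod_restrict, lintegral_prod_symm]
  · rfl
  · refine Measurable.aemeasurable ?_
    simp only [smul_eq_mul]
    refine (ENNReal.measurable_ofReal.comp measurable_fst).mul ?_
    exact (hH.comp h1.measurable).comp continuous_polarCoord_symm.measurable

/-- truncated kernel `1/|y|` -/
def ker2 (I : Set ℝ) (y : E2) : ENNReal :=
  I.indicator (fun r => ENNReal.ofReal r⁻¹) ‖y‖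

lemma ker2_meas (I : Set ℝ) (hI : MeasurableSet I) : Measurable (ker2 I) := by
  unfold ker2
  refine Measurable.comp (g := I.indicator (fun r => ENNReal.ofReal r⁻¹)) ?_ measurable_norm
  exact (by fun_prop : Measurable (fun r : ℝ => ENNReal.ofReal r⁻¹)).indicator hI

lemma lintegral_ker2 (I : Set ℝ) (hI : MeasurableSet I) (h0 : I ⊆ Ioi 0) (p : ℝ) (hp : 0 < p) :
    ∫⁻ y, ker2 I y ^ p =
      ENNReal.ofReal (2 * Real.pi) * ∫⁻ r in I, ENNReal.ofReal (r ^ (1 - p)) := by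
  rw [lintegral_polar _ ((ker2_meas I hI).pow_const p)]
  have : ∀ θ : ℝ, ∫⁻ r in Ioi (0:ℝ), ENNReal.ofReal r * ker2 I (ePol r θ) ^ p
      = ∫⁻ r in I, ENNReal.ofReal (r ^ (1 - p)) := by
    intro θ
    rw [← lintegral_indicator hI, ← lintegral_indicator measurableSet_Ioi]
    congr 1; ext r
    by_cases hr : r ∈ I
    · have hr0 : 0 < r := h0 hr
      rw [indicator_of_mem (show r ∈ Ioi (0:ℝ) from hr0), indicator_of_mem hr, ker2,
        norm_ePol _ _ hr0.le, indicator_of_mem hr, ENNReal.ofReal_rpow_of_pos (by positivity),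
        ← ENNReal.ofReal_mul hr0.le, Real.rpow_sub hr0, Real.rpow_one, Real.inv_rpow hr0.le]
      rfl
    · rw [indicator_of_notMem hr]
      by_cases hr0 : r ∈ Ioi (0:ℝ)
      · rw [indicator_of_mem hr0, ker2, norm_ePol _ _ (le_of_lt hr0), indicator_of_notMem hr,
          ENNReal.zero_rpow_of_pos hp, mul_zero]
      · rw [indicator_of_notMem hr0]
  simp_rw [this]
  rw [setLIntegral_const, Real.volume_Ioo, mul_comm]
  congr 2; ring

/-- integral over sector without weight -/
def JJ (G : E2 → ENNReal) (I : Set ℝ) : ENNReal :=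
  ∫⁻ θ in Ioo (-Real.pi) Real.pi, ∫⁻ r in I, G (ePol r θ)

lemma JJ_le (G : E2 → ENNReal) (hG : Measurable G) (I : Set ℝ) (hI : MeasurableSet I)
    (h0 : I ⊆ Ioi 0) (p q : ℝ) (hpq : p.HolderConjugate q) :
    JJ G I ≤ (∫⁻ y, G y ^ p) ^ (1 / p) *
      (ENNReal.ofReal (2 * Real.pi) * ∫⁻ r in I, ENNReal.ofReal (r ^ (1 - q))) ^ (1 / q) := by
  rw [← lintegral_ker2 I hI h0 q hpq.symm.pos]
  refine le_trans (le_of_eq ?_) (ENNReal.lintegral_mul_le_Lp_mul_Lq volume hpq hG.aemeasurable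
    (ker2_meas I hI).aemeasurable)
  rw [lintegral_polar _ (hG.mul (ker2_meas I hI)), JJ]
  congr 1; ext θ
  rw [← lintegral_indicator hI, ← lintegral_indicator measurableSet_Ioi]
  congr 1; ext r
  by_cases hr : r ∈ I
  · have hr0 : 0 < r := h0 hr
    rw [indicator_of_mem (show r ∈ Ioi (0:ℝ) from hr0), indicator_of_mem hr, Pi.mul_apply, ker2,
      norm_ePol _ _ hr0.le, indicator_of_mem hr, mul_left_comm,
      ← ENNReal.ofReal_mul hr0.le, mul_inv_cancel₀ hr0.ne', ENNReal.ofReal_one, mul_one]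
  · rw [indicator_of_notMem hr]
    by_cases hr0 : r ∈ Ioi (0:ℝ)
    · rw [indicator_of_mem hr0, Pi.mul_apply, ker2, norm_ePol _ _ (le_of_lt hr0),
        indicator_of_notMem hr, mul_zero, mul_zero]
    · rw [indicator_of_notMem hr0]

lemma rad_rpow (R s : ℝ) (hR : 0 < R) (hs : -1 < s) :
    ∫⁻ r in Ioc 0 R, ENNReal.ofReal (r ^ s) = ENNReal.ofReal (R ^ (s + 1) / (s + 1)) := by
  rw [← ofReal_integral_eq_lintegral_ofReal]
  · rw [← intervalIntegral.integral_of_le hR.le, integral_rpow (Or.inl hs),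
      Real.zero_rpow (by linarith), sub_zero]
  · exact (intervalIntegrable_iff_integrableOn_Ioc_of_le hR.le).1
      (intervalIntegral.intervalIntegrable_rpow' hs)
  · exact (ae_restrict_mem measurableSet_Ioc).mono fun r hr => Real.rpow_nonneg hr.1.le _

lemma rad_log (ρ R : ℝ) (hρ : 0 < ρ) (hR : ρ ≤ R) :
    ∫⁻ r in Ioc ρ R, ENNReal.ofReal (r ^ (1 - 2 : ℝ)) = ENNReal.ofReal (Real.log (R / ρ)) := by
  have : ∀ r : ℝ, r ^ (1 - 2 : ℝ) = r⁻¹ := fun r => by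
    rw [← Real.rpow_neg_one]; norm_num
  simp_rw [this]
  rw [← ofReal_integral_eq_lintegral_ofReal]
  · rw [← intervalIntegral.integral_of_le hR, integral_inv_of_pos hρ (hρ.trans_le hR)]
  · refine (intervalIntegrable_iff_integrableOn_Ioc_of_le hR).1 ?_
    refine intervalIntegral.intervalIntegrable_inv (fun x hx => ?_) continuousOn_id
    rw [uIcc_of_le hR] at hx
    exact (hρ.trans_le hx.1).ne'
  · exact (ae_restrict_mem measurableSet_Ioc).mono fun r hr => inv_nonneg.2 (hρ.trans hr.1).le

lemma enorm_grad (f : E2 → ℝ) (x : E2) : ‖gradient f x‖ = ‖fderiv ℝ f x‖ := by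
  simp [gradient]

lemma ray (f : E2 → ℝ) (hf : ContDiff ℝ (⊤ : ℕ∞) f) (x : E2) (θ R : ℝ) (hR : 0 < R) :
    ‖f x‖ₑ ≤ ∫⁻ r in Ioc 0 R, (ENNReal.ofReal R⁻¹ * ‖f (x + ePol r θ)‖ₑ
      + ‖gradient f (x + ePol r θ)‖ₑ) := by
  set v := ePol 1 θ with hv
  have hvn : ‖v‖ = 1 := norm_ePol 1 θ zero_le_one
  have hd : Differentiable ℝ f := hf.differentiable (by simp)
  have hfc : Continuous (fderiv ℝ f) := hf.continuous_fderiv (by simp)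
  have hfcont := hf.continuous
  have hder : ∀ t : ℝ, HasDerivAt (fun t : ℝ => (1 - t * R⁻¹) * f (x + t • v))
      ((-R⁻¹) * f (x + t • v) + (1 - t * R⁻¹) * fderiv ℝ f (x + t • v) v) t := by
    intro t
    have h1 : HasDerivAt (fun t : ℝ => 1 - t * R⁻¹) (-R⁻¹) t := by
      simpa using ((hasDerivAt_id t).mul_const R⁻¹).const_sub 1
    have h2 : HasDerivAt (fun t : ℝ => x + t • v) v t := by
      simpa using ((hasDerivAt_id t).smul_const v).const_add x
    exact h1.mul ((hd (x + t • v)).hasFDerivAt.comp_hasDerivAt t h2)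
  have hint := intervalIntegral.integral_eq_sub_of_hasDerivAt (a := 0) (b := R)
    (fun t _ => hder t) (Continuous.intervalIntegrable (by fun_prop) _ _)
  rw [mul_inv_cancel₀ hR.ne'] at hint
  simp only [sub_self, zero_mul, sub_zero, one_mul, zero_smul, add_zero, zero_sub] at hint
  rw [← enorm_neg, ← hint, intervalIntegral.integral_of_le hR.le]
  refine (enorm_integral_le_lintegral_enorm _).trans ?_
  refine lintegral_mono_ae ((ae_restrict_mem measurableSet_Ioc).mono fun r hr => ?_)
  rw [ePol_eq r θ, ← hv]
  refine (enorm_add_le _ _).trans ?_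
  refine add_le_add (le_of_eq ?_) ?_
  · rw [enorm_mul, enorm_neg, Real.enorm_of_nonneg (inv_nonneg.2 hR.le)]
  · rw [← ofReal_norm, ← ofReal_norm, enorm_grad]
    refine ENNReal.ofReal_le_ofReal ?_
    rw [norm_mul]
    have h3 : ‖1 - r * R⁻¹‖ ≤ 1 := by
      have : r * R⁻¹ ≤ 1 := by rw [← div_eq_mul_inv]; exact (div_le_one hR).2 hr.2
      have h4 : 0 < r * R⁻¹ := mul_pos hr.1 (inv_pos.2 hR)
      rw [Real.norm_eq_abs, abs_le]; constructor <;> linarith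
    have h5 := (fderiv ℝ f (x + r • v)).le_opNorm v
    rw [hvn, mul_one] at h5
    calc _ ≤ 1 * ‖fderiv ℝ f (x + r • v)‖ := by gcongr
      _ = _ := one_mul _

set_option maxHeartbeats 2000000 in
lemma JJ_total (f : E2 → ℝ) (hf : ContDiff ℝ (⊤ : ℕ∞) f) (x : E2) (ρ R : ℝ) (hρ : 0 < ρ)
    (hR : ρ ≤ R) :
    ENNReal.ofReal (2 * Real.pi) * ‖f x‖ₑ ≤
      ENNReal.ofReal R⁻¹ * JJ (fun y => ‖f (x + y)‖ₑ) (Ioc 0 R) +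
      (JJ (fun y => ‖gradient f (x + y)‖ₑ) (Ioc 0 ρ) +
        JJ (fun y => ‖gradient f (x + y)‖ₑ) (Ioc ρ R)) := by
  have hfc : Continuous (fderiv ℝ f) := hf.continuous_fderiv (by simp)
  have hfcont := hf.continuous
  have hgc : Continuous (gradient f) := by unfold gradient; fun_prop
  have he := ePol_cont
  have m1 : Measurable (fun p : ℝ × ℝ => ‖f (x + ePol p.1 p.2)‖ₑ) := by
    exact (hfcont.comp (continuous_const.add he)).measurable.enorm
  have m2 : Measurable (fun p : ℝ × ℝ => ‖gradient f (x + ePol p.1 p.2)‖ₑ) := by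
    exact (hgc.comp (continuous_const.add he)).measurable.enorm
  have mm : ∀ I : Set ℝ, Measurable (fun θ : ℝ => ∫⁻ r in I, ‖gradient f (x + ePol r θ)‖ₑ) :=
    fun I => m2.lintegral_prod_left'
  have mm1 : ∀ I : Set ℝ, Measurable (fun θ : ℝ => ∫⁻ r in I, ‖f (x + ePol r θ)‖ₑ) :=
    fun I => m1.lintegral_prod_left'
  unfold JJ
  rw [← lintegral_add_left (mm _), ← lintegral_const_mul _ (mm1 _),
    ← lintegral_add_left ((mm1 _).const_mul _)]
  have hc : ENNReal.ofReal (2 * Real.pi) * ‖f x‖ₑ =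
      ∫⁻ θ in Ioo (-Real.pi) Real.pi, ‖f x‖ₑ := by
    rw [setLIntegral_const, Real.volume_Ioo, mul_comm]; congr 2; ring
  rw [hc]
  refine lintegral_mono fun θ => ?_
  refine (ray f hf x θ R (hρ.trans_le hR)).trans (le_of_eq ?_)
  have m1' : Measurable (fun r : ℝ => ‖f (x + ePol r θ)‖ₑ) :=
    m1.comp (measurable_id.prodMk measurable_const)
  rw [lintegral_add_left (m1'.const_mul _), lintegral_const_mul _ m1',
    ← Ioc_union_Ioc_eq_Ioc hρ.le hR, lintegral_union measurableSet_Ioc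
      (Ioc_disjoint_Ioc_of_le le_rfl), lintegral_union measurableSet_Ioc
      (Ioc_disjoint_Ioc_of_le le_rfl)]

lemma shift_norm {F : Type*} [NormedAddCommGroup F] (g : E2 → F) (x : E2) (p : ℝ) (hp : 0 < p) :
    (∫⁻ y, ‖g (x + y)‖ₑ ^ p) ^ (1 / p) = eLpNorm g (ENNReal.ofReal p) volume := by
  rw [eLpNorm_eq_lintegral_rpow_enorm_toReal (by simpa using hp) ENNReal.ofReal_ne_top,
    ENNReal.toReal_ofReal hp.le, lintegral_add_left_eq_self (fun y => ‖g y‖ₑ ^ p) x]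

lemma pt_bound (q : ℝ) (hq : 2 < q) : ∃ K > 0, ∀ f : E2 → ℝ, ContDiff ℝ (⊤ : ℕ∞) f →
    HasCompactSupport f → ∀ (x : E2) (ρ R : ℝ), 0 < ρ → ρ ≤ R →
    2 * Real.pi * ‖f x‖ ≤ 
      R⁻¹ * ((eLpNorm f (ENNReal.ofReal q) volume).toReal * (K * R ^ (1 - 2 / q))) +
      ((eLpNorm (fun x => ‖gradient f x‖) (ENNReal.ofReal q) volume).toReal *
        (K * ρ ^ (1 - 2 / q)) + 
      (eLpNorm (fun x => ‖gradient f x‖) 2 volume).toReal *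
        Real.sqrt (2 * Real.pi * Real.log (R / ρ))) := by
  have hq0 : 0 < q := by linarith
  have hq1 : 0 < q - 1 := by linarith
  set q' := q / (q - 1) with hq'
  have hconj : q.HolderConjugate q' := Real.HolderConjugate.conjExponent (by linarith)
  have hq'2 : 0 < 2 - q' := by
    have : q' < 2 := by rw [hq', div_lt_iff₀ hq1]; linarith
    linarith
  have hq'0 : 0 < q' := hconj.symm.pos
  have hpi := Real.pi_pos
  refine ⟨(2 * Real.pi / (2 - q')) ^ (1 / q'), by positivity, fun f hf hs x ρ R hρ hR => ?_⟩
  have hR0 := hρ.trans_le hR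
  have hfc : Continuous (fderiv ℝ f) := hf.continuous_fderiv (by simp)
  have hfcont := hf.continuous
  have hgc : Continuous (gradient f) := by unfold gradient; fun_prop
  have hgs : HasCompactSupport (gradient f) := by
    unfold gradient
    exact (hs.fderiv (𝕜 := ℝ)).comp_left (g := (InnerProductSpace.toDual ℝ E2).symm) (by simp)
  have hgn : ∀ p, eLpNorm (fun x => ‖gradient f x‖) p volume = eLpNorm (gradient f) p volume :=
    fun p => eLpNorm_norm _
  have hgfin : ∀ p, eLpNorm (gradient f) p volume ≠ ⊤ := fun p =>
    (hgc.memLp_of_hasCompactSupport hgs).2.ne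
  have hffin : ∀ p, eLpNorm f p volume ≠ ⊤ := fun p =>
    (hfcont.memLp_of_hasCompactSupport hs).2.ne
  simp only [hgn]
  have hrad : ∀ r : ℝ, 0 < r → (ENNReal.ofReal (2 * Real.pi) *
      ∫⁻ s in Ioc 0 r, ENNReal.ofReal (s ^ (1 - q'))) ^ (1 / q') =
      ENNReal.ofReal ((2 * Real.pi / (2 - q')) ^ (1 / q') * r ^ (1 - 2 / q)) := by
    intro r hr
    rw [rad_rpow r _ hr (by linarith), ← ENNReal.ofReal_mul (by positivity),
      ENNReal.ofReal_rpow_of_nonneg _ (by positivity)]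
    · congr 1
      rw [show 1 - q' + 1 = 2 - q' by ring, mul_div_assoc', mul_div_right_comm,
        Real.mul_rpow (by positivity) (by positivity), ← Real.rpow_mul hr.le]
      congr 2
      rw [hq']; field_simp; ring
    · have : 0 < 1 - q' + 1 := by linarith
      positivity
  have mF : Measurable (fun y => ‖f (x + y)‖ₑ) :=
    (hfcont.comp (continuous_const.add continuous_id)).measurable.enorm
  have mG : Measurable (fun y => ‖gradient f (x + y)‖ₑ) :=
    (hgc.comp (continuous_const.add continuous_id)).measurable.enorm
  have hlog : 0 ≤ Real.log (R / ρ) := Real.log_nonneg ((one_le_div hρ).2 hR)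
  have b1 := JJ_le _ mF (Ioc 0 R) measurableSet_Ioc (fun r hr => hr.1) q q' hconj
  have b2 := JJ_le _ mG (Ioc 0 ρ) measurableSet_Ioc (fun r hr => hr.1) q q' hconj
  have b3 := JJ_le _ mG (Ioc ρ R) measurableSet_Ioc (fun r hr => hρ.trans hr.1) 2 2
    Real.HolderConjugate.two_two
  rw [shift_norm f x q hq0, hrad R hR0, ← ENNReal.ofReal_toReal (hffin _),
    ← ENNReal.ofReal_mul ENNReal.toReal_nonneg] at b1
  rw [shift_norm (gradient f) x q hq0, hrad ρ hρ, ← ENNReal.ofReal_toReal (hgfin _),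
    ← ENNReal.ofReal_mul ENNReal.toReal_nonneg] at b2
  rw [shift_norm (gradient f) x 2 two_pos, rad_log ρ R hρ hR,
    ← ENNReal.ofReal_toReal (hgfin _), ← ENNReal.ofReal_mul (by positivity),
    ENNReal.ofReal_rpow_of_nonneg (by positivity) (by positivity),
    ← ENNReal.ofReal_mul ENNReal.toReal_nonneg, ← Real.sqrt_eq_rpow, ENNReal.ofReal_ofNat] at b3
  have ht := (JJ_total f hf x ρ R hρ hR).trans
    (add_le_add (mul_le_mul_right b1 _) (add_le_add b2 b3))
  rw [← ofReal_norm, ← ENNReal.ofReal_mul (by positivity), ← ENNReal.ofReal_mul (by positivity),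
    ← ENNReal.ofReal_add (by positivity) (by positivity),
    ← ENNReal.ofReal_add (by positivity) (by positivity)] at ht
  exact (ENNReal.ofReal_le_ofReal_iff (by positivity)).1 ht

/-- **Logarithmic (Brezis–Gallouet type) Sobolev inequality in dimension two.**
For every `q > 2` there exists a constant `C > 0`, depending only on `q`, such that for every
smooth compactly supported `f : ℝ² → ℝ` one has
`‖f‖_{L^∞} ≤ C ‖∇f‖_{L²} (ln(e + ‖f‖_{L^q} + ‖∇f‖_{L^q}))^{1/2} + C`. -/
theorem log_sobolev_plane (q : ℝ) (hq : 2 < q) :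
    ∃ C > 0, ∀ f : E2 → ℝ, ContDiff ℝ (⊤ : ℕ∞) f → HasCompactSupport f →
      (eLpNorm f ⊤ volume).toReal ≤
        C * (eLpNorm (fun x => ‖gradient f x‖) 2 volume).toReal *
          Real.sqrt (Real.log (Real.exp 1 +
            (eLpNorm f (ENNReal.ofReal q) volume).toReal +
            (eLpNorm (fun x => ‖gradient f x‖) (ENNReal.ofReal q) volume).toReal)) + C := by
  obtain ⟨K, hK, H⟩ := pt_bound q hq
  have hq0 : 0 < q := by linarith
  have hq2 : 0 < q - 2 := by linarith
  set α := q / 2 + q / (q - 2) with hα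
  have hα0 : 0 < α := by positivity
  have hpi := Real.pi_gt_three
  set S := Real.sqrt (2 * Real.pi * α) with hS
  have hS0 : 0 ≤ S := Real.sqrt_nonneg _
  refine ⟨2 * K + S, by positivity, fun f hf hs => ?_⟩
  set B := (eLpNorm f (ENNReal.ofReal q) volume).toReal with hB
  set D := (eLpNorm (fun x => ‖gradient f x‖) (ENNReal.ofReal q) volume).toReal with hD
  set A := (eLpNorm (fun x => ‖gradient f x‖) 2 volume).toReal with hA
  have hA0 : 0 ≤ A := ENNReal.toReal_nonneg
  have hB0 : 0 ≤ B := ENNReal.toReal_nonneg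
  have hD0 : 0 ≤ D := ENNReal.toReal_nonneg
  set M := Real.exp 1 + B + D with hM
  have hM1 : 1 ≤ M := by
    have := Real.add_one_le_exp 1
    linarith
  have hM0 : 0 < M := by linarith
  have hBM : B ≤ M := by have := Real.exp_pos 1; linarith
  have hDM : D ≤ M := by have := Real.exp_pos 1; linarith
  set L := Real.sqrt (Real.log M) with hL
  have hL0 : 0 ≤ L := Real.sqrt_nonneg _
  have key : ∀ x, ‖f x‖ ≤ (2 * K + S) * A * L + (2 * K + S) := by
    intro x
    have h := H f hf hs x (M ^ (-(q / (q - 2)))) (M ^ (q / 2)) (by positivity)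
      (Real.rpow_le_rpow_of_exponent_le hM1 (by
        have : 0 < q / (q - 2) := by positivity
        have : 0 < q / 2 := by positivity
        linarith))
    rw [← hB, ← hD, ← hA] at h
    have e1 : (M ^ (q / 2))⁻¹ * (M ^ (q / 2)) ^ (1 - 2 / q) = M⁻¹ := by
      rw [← Real.rpow_mul hM0.le, ← Real.rpow_neg hM0.le, ← Real.rpow_add hM0,
        ← Real.rpow_neg_one]
      congr 1; field_simp; ring
    have e2 : (M ^ (-(q / (q - 2)))) ^ (1 - 2 / q) = M⁻¹ := by
      rw [← Real.rpow_mul hM0.le, ← Real.rpow_neg_one]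
      congr 1; field_simp
    have e3 : Real.log (M ^ (q / 2) / M ^ (-(q / (q - 2)))) = α * Real.log M := by
      rw [← Real.rpow_sub hM0, Real.log_rpow hM0, hα]; ring
    rw [e2, e3, ← mul_assoc (2 * Real.pi), Real.sqrt_mul (by positivity), ← hS, ← hL] at h
    have t1 : (M ^ (q / 2))⁻¹ * (B * (K * (M ^ (q / 2)) ^ (1 - 2 / q))) ≤ K := by
      calc _ = K * (B * M⁻¹) := by rw [← e1]; ring
        _ ≤ K * 1 := by
          gcongr; rw [← div_eq_mul_inv]; exact (div_le_one hM0).2 hBM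
        _ = K := mul_one K
    have t2 : D * (K * M⁻¹) ≤ K := by
      calc _ = K * (D * M⁻¹) := by ring
        _ ≤ K * 1 := by
          gcongr; rw [← div_eq_mul_inv]; exact (div_le_one hM0).2 hDM
        _ = K := mul_one K
    have t3 : ‖f x‖ ≤ 2 * Real.pi * ‖f x‖ := by
      nlinarith [norm_nonneg (f x)]
    have t4 : 0 ≤ K * (A * L) := by positivity
    nlinarith
  refine ENNReal.toReal_le_of_le_ofReal (by positivity) ?_
  rw [eLpNorm_exponent_top]
  exact eLpNormEssSup_le_of_ae_bound (Filter.Eventually.of_forall key)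
end
end

section
/- Let T > 0, ρ̄ > 0, and suppose ρ, P : ℝ³ × [0,T] → ℝ and u : ℝ³ × [0,T] → ℝ³ are smooth, ρ ≥ 0 everywhere, there is a compact set K ⊂ ℝ³ such that u(·,t) and ρ(·,t) − ρ̄ are supported in K for every t ∈ [0,T], and (ρ, u, P) satisfies pointwise on ℝ³ × [0,T] the system ρ∂ₜu + ρ(u·∇)u − Δu + ∇P = 0, ∂ₜρ + u·∇ρ = 0, div u = 0. Then there is a constant M, depending only on ∫_{ℝ³} ρ(x,0)|u(x,0)|² dx, ‖ρ(·,0) − ρ̄‖_{L^{3/2}(ℝ³)}, ρ̄^{-1}, and T, such that sup_{0≤t≤T} ∫_{ℝ³} ρ(x,t)|u(x,t)|² dx + ∫_0^T ∫_{ℝ³} ( |u|² + |∇u|² ) dx dt ≤ M. -/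
open MeasureTheory Set

noncomputable section

/-- Three-dimensional Euclidean space. -/
abbrev E3 := EuclideanSpace ℝ (Fin 3)

/-- Squared Frobenius norm of the (spatial) Jacobian matrix of a vector field. -/
def frobSq (u : E3 → E3) (x : E3) : ℝ :=
  ∑ i : Fin 3, ‖fderiv ℝ u x (EuclideanSpace.single i 1)‖ ^ 2

/-- Componentwise Laplacian of a vector field. -/
def vecLap (u : E3 → E3) (x : E3) : E3 :=
  ∑ i : Fin 3,
    fderiv ℝ (fun y => fderiv ℝ u y (EuclideanSpace.single i 1)) x (EuclideanSpace.single i 1)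

/-- Divergence of a vector field. -/
def divg (u : E3 → E3) (x : E3) : ℝ :=
  ∑ i : Fin 3, fderiv ℝ u x (EuclideanSpace.single i 1) i

lemma cont_fderiv_apply {F : Type*} [NormedAddCommGroup F] [NormedSpace ℝ F] {f : E3 → F}
    (hf : ContDiff ℝ 1 f) (e : E3) : Continuous (fun x => fderiv ℝ f x e) :=
  (hf.continuous_fderiv one_ne_zero).clm_apply continuous_const

lemma e3_sum (v : E3) : v = ∑ i : Fin 3, v i • (EuclideanSpace.single i 1 : E3) := by
  ext j
  fin_cases j <;> simp [Fin.sum_univ_three]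

lemma fderiv_comp_coord {v : E3 → E3} (hv : ContDiff ℝ 1 v) (i : Fin 3) (x e : E3) :
    fderiv ℝ (fun y => v y i) x e = fderiv ℝ v x e i := by
  have h := (hv.differentiable one_ne_zero x).hasFDerivAt
  have h2 := (EuclideanSpace.proj i : E3 →L[ℝ] ℝ).hasFDerivAt.comp x h
  have h3 : HasFDerivAt (fun y => v y i)
    ((EuclideanSpace.proj i : E3 →L[ℝ] ℝ).comp (fderiv ℝ v x)) x := h2
  rw [h3.fderiv]; rfl

/-- Transport by a compactly supported divergence-free field integrates to zero. -/
lemma integral_transport_zero {φ : E3 → ℝ} {v : E3 → E3} (hφ : ContDiff ℝ 1 φ)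
    (hv : ContDiff ℝ 1 v) (hc : HasCompactSupport v) (hd : ∀ x, divg v x = 0) :
    ∫ x, fderiv ℝ φ x (v x) = 0 := by
  have hvi : ∀ i : Fin 3, ContDiff ℝ 1 (fun y => v y i) := fun i => by fun_prop
  have hci : ∀ i : Fin 3, HasCompactSupport (fun y => v y i) := fun i =>
    hc.comp_left (g := fun w : E3 => w i) rfl
  have hcdi : ∀ i : Fin 3, HasCompactSupport
      (fun x => fderiv ℝ (fun y => v y i) x (EuclideanSpace.single i 1)) := fun i =>
    (hci i).fderiv_apply (𝕜 := ℝ) _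
  have I1 : ∀ i : Fin 3, Integrable (fun x =>
      fderiv ℝ (fun y => v y i) x (EuclideanSpace.single i 1) * φ x) := fun i =>
    ((cont_fderiv_apply (hvi i) _).mul hφ.continuous).integrable_of_hasCompactSupport
      ((hcdi i).mul_right)
  have I2 : ∀ i : Fin 3, Integrable (fun x =>
      v x i * fderiv ℝ φ x (EuclideanSpace.single i 1)) := fun i =>
    ((hvi i).continuous.mul (cont_fderiv_apply hφ _)).integrable_of_hasCompactSupport
      ((hci i).mul_right)
  have I3 : ∀ i : Fin 3, Integrable (fun x => v x i * φ x) := fun i =>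
    ((hvi i).continuous.mul hφ.continuous).integrable_of_hasCompactSupport
      ((hci i).mul_right)
  have key : ∀ i : Fin 3, ∫ x, v x i * fderiv ℝ φ x (EuclideanSpace.single i 1)
      = - ∫ x, fderiv ℝ (fun y => v y i) x (EuclideanSpace.single i 1) * φ x := fun i =>
    integral_mul_fderiv_eq_neg_fderiv_mul_of_integrable (I1 i) (I2 i) (I3 i)
      (fun x _ => (hvi i).differentiable one_ne_zero x)
      (fun x _ => hφ.differentiable one_ne_zero x)
  have e1 : ∀ x, fderiv ℝ φ x (v x) =
      ∑ i : Fin 3, v x i * fderiv ℝ φ x (EuclideanSpace.single i 1) := fun x => by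
    conv_lhs => rw [e3_sum (v x)]
    simp [map_sum]
  simp_rw [e1]
  rw [integral_finsetSum _ (fun i _ => I2 i)]
  simp_rw [key]
  rw [Finset.sum_neg_distrib, ← integral_finsetSum _ (fun i _ => I1 i), neg_eq_zero]
  have e2 : ∀ x, ∑ i : Fin 3, fderiv ℝ (fun y => v y i) x (EuclideanSpace.single i 1) * φ x = 0 := by
    intro x
    rw [← Finset.sum_mul]
    have := hd x
    unfold divg at this
    simp_rw [fderiv_comp_coord hv, this, zero_mul]
  simp [e2]

lemma integral_inner_lap {v : E3 → E3} (hv : ContDiff ℝ 2 v) (hc : HasCompactSupport v) :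
    ∫ x, inner ℝ (v x) (vecLap v x) = - ∫ x, frobSq v x := by
  have hv1 : ContDiff ℝ 1 v := hv.of_le (by norm_num)
  have hD : ∀ i : Fin 3, ContDiff ℝ 1 (fun y => fderiv ℝ v y (EuclideanSpace.single i 1)) :=
    fun i => (hv.fderiv_right (by norm_num)).clm_apply contDiff_const
  have hcD : ∀ i : Fin 3, HasCompactSupport (fun y => fderiv ℝ v y (EuclideanSpace.single i 1)) :=
    fun i => hc.fderiv_apply (𝕜 := ℝ) _
  have cs : ∀ {f g : E3 → E3}, Continuous f → Continuous g → HasCompactSupport f →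
      Integrable (fun x => inner ℝ (f x) (g x)) := fun {f g} hf hg h =>
    (hf.inner hg).integrable_of_hasCompactSupport
      (HasCompactSupport.intro h (fun x hx => by rw [image_eq_zero_of_notMem_tsupport hx]; simp))
  have I1 : ∀ i : Fin 3, Integrable (fun x => inner ℝ (fderiv ℝ v x (EuclideanSpace.single i 1))
      (fderiv ℝ v x (EuclideanSpace.single i 1))) := fun i =>
    cs (hD i).continuous (hD i).continuous (hcD i)
  have I2 : ∀ i : Fin 3, Integrable (fun x => inner ℝ (v x)
      (fderiv ℝ (fun y => fderiv ℝ v y (EuclideanSpace.single i 1)) x (EuclideanSpace.single i 1))) :=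
    fun i => cs hv.continuous (cont_fderiv_apply (hD i) _) hc
  have I3 : ∀ i : Fin 3, Integrable (fun x => inner ℝ (v x)
      (fderiv ℝ v x (EuclideanSpace.single i 1))) :=
    fun i => cs hv.continuous (hD i).continuous hc
  have key : ∀ i : Fin 3, ∫ x, inner ℝ (v x)
      (fderiv ℝ (fun y => fderiv ℝ v y (EuclideanSpace.single i 1)) x (EuclideanSpace.single i 1))
      = - ∫ x, inner ℝ (fderiv ℝ v x (EuclideanSpace.single i 1))
      (fderiv ℝ v x (EuclideanSpace.single i 1)) := fun i =>
    integral_bilinear_fderiv_right_eq_neg_left_of_integrable (B := innerSL ℝ) (I1 i) (I2 i) (I3 i)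
      (fun x _ => hv1.differentiable one_ne_zero x)
      (fun x _ => (hD i).differentiable one_ne_zero x)
  unfold vecLap frobSq
  simp_rw [inner_sum]
  rw [integral_finsetSum _ (fun i _ => I2 i)]
  simp_rw [key, ← real_inner_self_eq_norm_sq]
  rw [Finset.sum_neg_distrib, ← integral_finsetSum _ (fun i _ => I1 i)]

lemma frob_zero_off {v : E3 → E3} {K : Set E3} (hK : IsCompact K) (h : ∀ x ∉ K, v x = 0) :
    ∀ x ∉ K, fderiv ℝ v x = 0 := by
  intro x hx
  have : v =ᶠ[nhds x] fun _ => 0 := by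
    filter_upwards [hK.isClosed.isOpen_compl.mem_nhds hx] with y hy using h y hy
  rw [this.fderiv_eq]; simp

/-- Fubini form of differentiation under the integral. -/
lemma integral_time_diff {f : E3 → ℝ → ℝ} (hf : ContDiff ℝ 1 (fun p : E3 × ℝ => f p.1 p.2))
    {K : Set E3} (hK : IsCompact K) {t : ℝ} (ht : 0 ≤ t) :
    (∫ x in K, f x t) - ∫ x in K, f x 0 = ∫ s in (0:ℝ)..t, ∫ x in K, deriv (f x) s := by
  have hfx : ∀ x, ContDiff ℝ 1 (f x) := fun x =>
    hf.comp (g := fun p : E3 × ℝ => f p.1 p.2) (f := fun s : ℝ => (x, s)) (by fun_prop)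
  have hder : ∀ x s, deriv (f x) s = fderiv ℝ (fun p : E3 × ℝ => f p.1 p.2) (x, s) (0, 1) := by
    intro x s
    have h1 := (hf.differentiable one_ne_zero (x, s)).hasFDerivAt
    have h2 : HasDerivAt (fun s : ℝ => (x, s)) ((0 : E3), (1 : ℝ)) s :=
      (hasDerivAt_const s x).prodMk (hasDerivAt_id s)
    exact (h1.comp_hasDerivAt s h2).deriv
  have hcont : Continuous (fun p : ℝ × E3 => deriv (f p.2) p.1) := by
    simp_rw [hder]
    have : Continuous (fun q : E3 × ℝ => fderiv ℝ (fun p : E3 × ℝ => f p.1 p.2) q (0, 1)) :=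
      (hf.continuous_fderiv one_ne_zero).clm_apply continuous_const
    exact this.comp (continuous_snd.prodMk continuous_fst)
  have hfub : Integrable (Function.uncurry fun (s : ℝ) (x : E3) => deriv (f x) s)
      ((volume.restrict (Set.uIoc 0 t)).prod (volume.restrict K)) := by
    rw [Measure.prod_restrict]
    have : IntegrableOn (Function.uncurry fun (s : ℝ) (x : E3) => deriv (f x) s)
      (Set.Icc 0 t ×ˢ K) ((volume : Measure ℝ).prod volume) :=
      hcont.continuousOn.integrableOn_compact (isCompact_Icc.prod hK)
    refine this.mono_set ?_
    refine Set.prod_mono ?_ le_rfl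
    rw [Set.uIoc_of_le ht]; exact Set.Ioc_subset_Icc_self
  rw [intervalIntegral_integral_swap hfub]
  have : ∀ s, IntegrableOn (fun x => f x s) K := fun s =>
    (hf.continuous.comp (g := fun p : E3 × ℝ => f p.1 p.2) (f := fun x : E3 => (x, s))
      (by fun_prop)).continuousOn.integrableOn_compact hK
  rw [← integral_sub (this t) (this 0)]
  congr 1
  ext x
  rw [intervalIntegral.integral_deriv_eq_sub]
  · exact fun s _ => (hfx x).differentiable one_ne_zero s
  · exact ((hfx x).continuous_deriv le_rfl).intervalIntegrable _ _

lemma norm_fderiv_sq_le (v : E3 → E3) (x : E3) : ‖fderiv ℝ v x‖ ^ 2 ≤ frobSq v x := by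
  have hnn : 0 ≤ frobSq v x := Finset.sum_nonneg fun i _ => by positivity
  have : ‖fderiv ℝ v x‖ ≤ Real.sqrt (frobSq v x) := by
    refine ContinuousLinearMap.opNorm_le_bound _ (Real.sqrt_nonneg _) fun w => ?_
    have hw : fderiv ℝ v x w = ∑ i : Fin 3, w i • fderiv ℝ v x (EuclideanSpace.single i 1) := by
      conv_lhs => rw [e3_sum w]
      simp [map_sum]
    have h1 : ‖fderiv ℝ v x w‖ ≤
        ∑ i : Fin 3, ‖fderiv ℝ v x (EuclideanSpace.single i 1)‖ * ‖w i‖ := by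
      rw [hw]
      refine (norm_sum_le _ _).trans (Finset.sum_le_sum fun i _ => ?_)
      rw [norm_smul, mul_comm]
    refine h1.trans ((Real.sum_mul_le_sqrt_mul_sqrt _ _ _).trans ?_)
    rw [EuclideanSpace.norm_eq w]
    rfl
  calc ‖fderiv ℝ v x‖ ^ 2 ≤ (Real.sqrt (frobSq v x)) ^ 2 := by gcongr
    _ = _ := Real.sq_sqrt hnn

lemma frobSq_continuous {v : E3 → E3} (hv : ContDiff ℝ 1 v) : Continuous (frobSq v) := by
  unfold frobSq
  exact continuous_finsetSum _ fun i _ => ((cont_fderiv_apply hv _).norm.pow 2)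

lemma frobSq_integrable {v : E3 → E3} (hv : ContDiff ℝ 1 v) (hc : HasCompactSupport v) :
    Integrable (frobSq v) := by
  refine (frobSq_continuous hv).integrable_of_hasCompactSupport
    (HasCompactSupport.intro hc fun x hx => ?_)
  have := frob_zero_off hc (fun x hx => image_eq_zero_of_notMem_tsupport hx) x hx
  simp [frobSq, this]

lemma gns : ∃ C : ℝ, 0 ≤ C ∧ ∀ v : E3 → E3, ContDiff ℝ 1 v → HasCompactSupport v →
    (∫ x, (‖v x‖ ^ 2) ^ (3 : ℝ)) ^ (1 / (3 : ℝ)) ≤ C * ∫ x, frobSq v x := by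
  refine ⟨((SNormLESNormFDerivOfEqConst E3 (volume : Measure E3) ((2 : NNReal) : ℝ) : NNReal) : ℝ) ^ 2,
    by positivity, fun v hv hc => ?_⟩
  set C0 := SNormLESNormFDerivOfEqConst E3 (volume : Measure E3) ((2 : NNReal) : ℝ)
  have hS := eLpNorm_le_eLpNorm_fderiv_of_eq (volume : Measure E3) hv hc (p := 2) (p' := 6)
    (by norm_num) (by simp) (by simp; norm_num)
  have m1 : MemLp v ((6 : NNReal) : ENNReal) volume := hv.continuous.memLp_of_hasCompactSupport hc
  have m2 : MemLp (fderiv ℝ v) ((2 : NNReal) : ENNReal) volume :=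
    (hv.continuous_fderiv one_ne_zero).memLp_of_hasCompactSupport (hc.fderiv (𝕜 := ℝ))
  rw [m1.eLpNorm_eq_integral_rpow_norm (by simp) (by simp),
    m2.eLpNorm_eq_integral_rpow_norm (by simp) (by simp)] at hS
  set A := ∫ x, ‖v x‖ ^ ((6 : NNReal) : ENNReal).toReal with hA
  set B := ∫ x, ‖fderiv ℝ v x‖ ^ ((2 : NNReal) : ENNReal).toReal with hB
  have hA0 : 0 ≤ A := integral_nonneg fun x => by positivity
  have hB0 : 0 ≤ B := integral_nonneg fun x => by positivity
  have hS2 : A ^ (1 / (6 : ℝ)) ≤ C0 * B ^ (1 / (2 : ℝ)) := by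
    have : ((C0 : NNReal) : ENNReal) = ENNReal.ofReal C0 := by simp
    rw [this, ← ENNReal.ofReal_mul (by positivity),
      ENNReal.ofReal_le_ofReal_iff (by positivity)] at hS
    simpa using hS
  have hBle : B ≤ ∫ x, frobSq v x := by
    refine integral_mono_of_nonneg (Filter.Eventually.of_forall fun x => by positivity)
      (frobSq_integrable hv hc) (Filter.Eventually.of_forall fun x => ?_)
    have := norm_fderiv_sq_le v x
    simpa using this
  have hA' : ∫ x, (‖v x‖ ^ 2) ^ (3 : ℝ) = A := by
    rw [hA]
    congr 1
    ext x
    rw [← Real.rpow_natCast, ← Real.rpow_mul (norm_nonneg _)]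
    norm_num
  rw [hA']
  have e1 : A ^ (1 / (3 : ℝ)) = (A ^ (1 / (6 : ℝ))) ^ 2 := by
    rw [← Real.rpow_natCast, ← Real.rpow_mul hA0]; norm_num
  have e2 : (B ^ (1 / (2 : ℝ))) ^ 2 = B := by
    rw [← Real.rpow_natCast, ← Real.rpow_mul hB0]; norm_num
  calc A ^ (1 / (3 : ℝ)) = (A ^ (1 / (6 : ℝ))) ^ 2 := e1
    _ ≤ (C0 * B ^ (1 / (2 : ℝ))) ^ 2 := by gcongr
    _ = C0 ^ 2 * B := by rw [mul_pow, e2]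
    _ ≤ _ := by gcongr

lemma holder_real (σ : E3 → ℝ) (v : E3 → E3) (hσ : Continuous σ)
    (hcσ : HasCompactSupport σ) (hv : ContDiff ℝ 1 v) (hc : HasCompactSupport v) :
    ∫ x, |σ x| * ‖v x‖ ^ 2 ≤
      (∫ x, |σ x| ^ (3 / 2 : ℝ)) ^ (1 / (3 / 2) : ℝ) * (∫ x, (‖v x‖ ^ 2) ^ (3 : ℝ)) ^ (1 / (3 : ℝ)) := by
  have hpq : Real.HolderConjugate (3 / 2 : ℝ) 3 := by
    rw [Real.holderConjugate_iff]; norm_num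
  have a1 : 0 ≤ᵐ[(volume : Measure E3)] fun x => |σ x| := Filter.Eventually.of_forall fun x => abs_nonneg (σ x)
  have a2 : 0 ≤ᵐ[(volume : Measure E3)] fun x => ‖v x‖ ^ 2 := Filter.Eventually.of_forall fun x => sq_nonneg ‖v x‖
  have k1 : HasCompactSupport (fun x => |σ x|) := HasCompactSupport.intro hcσ fun x hx => by
    rw [image_eq_zero_of_notMem_tsupport hx, abs_zero]
  have k2 : HasCompactSupport (fun x => ‖v x‖ ^ 2) := HasCompactSupport.intro hc fun x hx => by
    rw [image_eq_zero_of_notMem_tsupport hx]; simp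
  have c2 : Continuous (fun x => ‖v x‖ ^ 2) := by
    have := hv.continuous
    fun_prop
  have m1 : MemLp (fun x => |σ x|) (ENNReal.ofReal (3 / 2)) (volume : Measure E3) :=
    hσ.abs.memLp_of_hasCompactSupport k1
  have m2 : MemLp (fun x => ‖v x‖ ^ 2) (ENNReal.ofReal 3) (volume : Measure E3) :=
    c2.memLp_of_hasCompactSupport k2
  exact integral_mul_le_Lp_mul_Lq_of_nonneg hpq a1 a2 m1 m2

lemma holder_sob : ∃ C : ℝ, 0 ≤ C ∧ ∀ (σ : E3 → ℝ) (v : E3 → E3), Continuous σ →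
    HasCompactSupport σ → ContDiff ℝ 1 v → HasCompactSupport v →
    ∫ x, |σ x| * ‖v x‖ ^ 2 ≤
      (∫ x, ‖σ x‖ ^ (3 / 2 : ℝ)) ^ (2 / 3 : ℝ) * (C * ∫ x, frobSq v x) := by
  obtain ⟨C, hC, h⟩ := gns
  refine ⟨C, hC, fun σ v hσ hcσ hv hc => ?_⟩
  refine (holder_real σ v hσ hcσ hv hc).trans ?_
  have : (1 / (3 / 2) : ℝ) = 2 / 3 := by norm_num
  rw [this]
  simp only [Real.norm_eq_abs]
  refine mul_le_mul_of_nonneg_left (h v hv hc) ?_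
  exact Real.rpow_nonneg (integral_nonneg fun x => Real.rpow_nonneg (abs_nonneg _) _) _

lemma integrable_transport {φ : E3 → ℝ} {v : E3 → E3} (hφ : ContDiff ℝ 1 φ)
    (hv : ContDiff ℝ 1 v) (hc : HasCompactSupport v) :
    Integrable (fun x => fderiv ℝ φ x (v x)) :=
  ((hφ.continuous_fderiv one_ne_zero).clm_apply hv.continuous).integrable_of_hasCompactSupport
    (HasCompactSupport.intro hc fun x hx => by rw [image_eq_zero_of_notMem_tsupport hx]; simp)

lemma integrable_inner_lap {v : E3 → E3} (hv : ContDiff ℝ 2 v) (hc : HasCompactSupport v) :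
    Integrable (fun x => inner ℝ (v x) (vecLap v x)) := by
  have hD : ∀ i : Fin 3, ContDiff ℝ 1 (fun y => fderiv ℝ v y (EuclideanSpace.single i 1)) :=
    fun i => (hv.fderiv_right (by norm_num)).clm_apply contDiff_const
  have hl : Continuous (vecLap v) :=
    continuous_finsetSum _ fun i _ => cont_fderiv_apply (hD i) _
  exact (hv.continuous.inner hl).integrable_of_hasCompactSupport
    (HasCompactSupport.intro hc fun x hx => by rw [image_eq_zero_of_notMem_tsupport hx]; simp)

lemma inner_gradient {p : E3 → ℝ} (x w : E3) :
    inner ℝ w (gradient p x) = fderiv ℝ p x w := by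
  rw [real_inner_comm]
  simp [gradient]

/-- Pointwise form of the energy identity. -/
lemma energy_pointwise {ρ P : E3 → ℝ → ℝ} {u : E3 → ℝ → E3} {x : E3} {s : ℝ}
    (hρx : Differentiable ℝ (ρ x)) (hux : Differentiable ℝ (u x))
    (hρs : Differentiable ℝ (fun y => ρ y s)) (hus : Differentiable ℝ (fun y => u y s))
    (hmom : ρ x s • deriv (u x) s + ρ x s • fderiv ℝ (fun y => u y s) x (u x s)
            - vecLap (fun y => u y s) x + gradient (fun y => P y s) x = 0)
    (hmass : deriv (ρ x) s + fderiv ℝ (fun y => ρ y s) x (u x s) = 0) :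
    deriv (fun τ => ρ x τ * ‖u x τ‖ ^ 2) s =
      - fderiv ℝ (fun y => ρ y s * ‖u y s‖ ^ 2) x (u x s)
      - 2 * fderiv ℝ (fun y => P y s) x (u x s)
      + 2 * inner ℝ (u x s) (vecLap (fun y => u y s) x) := by
  have h1 := ((hρx s).hasDerivAt.mul (hux s).hasDerivAt.norm_sq).deriv
  have h2 := ((hρs x).hasFDerivAt.mul (hus x).hasFDerivAt.norm_sq).fderiv
  have h1' : deriv (fun τ => ρ x τ * ‖u x τ‖ ^ 2) s =
      deriv (ρ x) s * ‖u x s‖ ^ 2 + ρ x s * (2 * inner ℝ (u x s) (deriv (u x) s)) := h1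
  have h2' : fderiv ℝ (fun y => ρ y s * ‖u y s‖ ^ 2) x (u x s) =
      ρ x s * (2 * inner ℝ (u x s) (fderiv ℝ (fun y => u y s) x (u x s)))
      + ‖u x s‖ ^ 2 * fderiv ℝ (fun y => ρ y s) x (u x s) := by
    have h4 : fderiv ℝ (fun y => ρ y s * ‖u y s‖ ^ 2) x = _ := h2
    rw [h4]
    simp
  rw [h1', h2', ← inner_gradient (p := fun y => P y s)]
  have h3 := congrArg (fun w => inner ℝ (u x s) w) hmom
  simp only [inner_add_right, inner_sub_right, inner_smul_right, inner_zero_right] at h3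
  linear_combination 2 * h3 + ‖u x s‖ ^ 2 * hmass

lemma mass_pointwise {ρ : E3 → ℝ → ℝ} {w : E3} {x : E3} {s : ℝ} {β : ℝ → ℝ}
    (hβ : Differentiable ℝ β)
    (hρx : Differentiable ℝ (ρ x)) (hρs : Differentiable ℝ (fun y => ρ y s))
    (hmass : deriv (ρ x) s + fderiv ℝ (fun y => ρ y s) x w = 0) :
    deriv (fun τ => β (ρ x τ)) s = - fderiv ℝ (fun y => β (ρ y s)) x w := by
  have h1 : deriv (fun τ => β (ρ x τ)) s = deriv β (ρ x s) * deriv (ρ x) s :=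
    ((hβ (ρ x s)).hasDerivAt.comp s (hρx s).hasDerivAt).deriv
  have h2 : HasFDerivAt (fun y => β (ρ y s)) (deriv β (ρ x s) • fderiv ℝ (fun y => ρ y s) x) x :=
    (hβ (ρ x s)).hasDerivAt.comp_hasFDerivAt x (hρs x).hasFDerivAt
  rw [h1, h2.fderiv]
  simp only [smul_apply, smul_eq_mul]
  linear_combination deriv β (ρ x s) * hmass

lemma frobSq_joint {u : E3 → ℝ → E3} (hu : ContDiff ℝ 1 (fun p : E3 × ℝ => u p.1 p.2)) :
    Continuous (Function.uncurry fun (s : ℝ) (x : E3) => frobSq (fun y => u y s) x) := by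
  have hder : ∀ x s e, fderiv ℝ (fun y => u y s) x e =
      fderiv ℝ (fun p : E3 × ℝ => u p.1 p.2) (x, s) (e, 0) := by
    intro x s e
    have h1 := (hu.differentiable one_ne_zero (x, s)).hasFDerivAt
    have h3 : HasFDerivAt (fun y => u y s)
        ((fderiv ℝ (fun p : E3 × ℝ => u p.1 p.2) (x, s)).comp (ContinuousLinearMap.inl ℝ E3 ℝ)) x :=
      h1.comp (f := fun y : E3 => (y, s)) x (hasFDerivAt_prodMk_left x s)
    rw [h3.fderiv]; simp
  unfold frobSq Function.uncurry
  simp_rw [hder]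
  refine continuous_finsetSum _ fun i _ => Continuous.pow (Continuous.norm ?_) 2
  have : Continuous (fun q : E3 × ℝ => fderiv ℝ (fun p : E3 × ℝ => u p.1 p.2) q
      ((EuclideanSpace.single i 1 : E3), (0 : ℝ))) :=
    (hu.continuous_fderiv one_ne_zero).clm_apply continuous_const
  exact this.comp (continuous_snd.prodMk continuous_fst)

set_option maxHeartbeats 2000000 in
/-- **Basic energy estimate** (Proposition 3.1 of the paper):
`sup_{0≤t≤T} ∫ ρ(t)|u(t)|² + ∫_0^T ∫ (|u|² + |∇u|²) ≤ M`, where `M` depends only on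
`∫ ρ(0)|u(0)|²`, `‖ρ(0) − ρ̄‖_{L^{3/2}}`, `ρ̄⁻¹`, and `T`. -/
theorem basic_energy_estimate :
    ∃ M : ℝ → ℝ → ℝ → ℝ → ℝ,
      ∀ T ρbar : ℝ, 0 < T → 0 < ρbar →
      ∀ (ρ P : E3 → ℝ → ℝ) (u : E3 → ℝ → E3),
        ContDiff ℝ (⊤ : ℕ∞) (fun p : E3 × ℝ => ρ p.1 p.2) →
        ContDiff ℝ (⊤ : ℕ∞) (fun p : E3 × ℝ => P p.1 p.2) →
        ContDiff ℝ (⊤ : ℕ∞) (fun p : E3 × ℝ => u p.1 p.2) →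
        (∀ x t, 0 ≤ ρ x t) →
        (∃ K : Set E3, IsCompact K ∧ ∀ t ∈ Set.Icc (0 : ℝ) T, ∀ x, x ∉ K →
          u x t = 0 ∧ ρ x t - ρbar = 0) →
        (∀ x, ∀ t ∈ Set.Icc (0 : ℝ) T,
          ρ x t • deriv (u x) t + ρ x t • fderiv ℝ (fun y => u y t) x (u x t)
            - vecLap (fun y => u y t) x + gradient (fun y => P y t) x = 0) →
        (∀ x, ∀ t ∈ Set.Icc (0 : ℝ) T,
          deriv (ρ x) t + fderiv ℝ (fun y => ρ y t) x (u x t) = 0) →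
        (∀ x, ∀ t ∈ Set.Icc (0 : ℝ) T, divg (fun y => u y t) x = 0) →
        ∀ t ∈ Set.Icc (0 : ℝ) T,
          (∫ x, ρ x t * ‖u x t‖ ^ 2)
              + (∫ τ in (0 : ℝ)..T, ∫ x, (‖u x τ‖ ^ 2 + frobSq (fun y => u y τ) x))
            ≤ M (∫ x, ρ x 0 * ‖u x 0‖ ^ 2)
                ((eLpNorm (fun x => ρ x 0 - ρbar) (ENNReal.ofReal (3 / 2)) volume).toReal)
                ρbar⁻¹ T := by
  obtain ⟨C, hC, hSob⟩ := holder_sob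
  refine ⟨fun e a b T => e + (T * (b * e) + (b * (a * C) + 1) * (e / 2)), ?_⟩
  intro T ρbar hT hρb ρ P u hρ hP hu hρ0 ⟨K, hK, hsupp⟩ hmom hmass hdiv t ht
  have hρ1 : ContDiff ℝ 1 (fun p : E3 × ℝ => ρ p.1 p.2) := hρ.of_le (by exact_mod_cast le_top)
  have hu1 : ContDiff ℝ 1 (fun p : E3 × ℝ => u p.1 p.2) := hu.of_le (by exact_mod_cast le_top)
  have hus : ∀ s, ContDiff ℝ 2 (fun y => u y s) := fun s =>
    (show ContDiff ℝ 2 (fun p : E3 × ℝ => u p.1 p.2) from contDiff_infty.mp hu 2).comp (g := fun p : E3 × ℝ => u p.1 p.2)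
      (f := fun y : E3 => (y, s)) (by fun_prop)
  have hus1 : ∀ s, ContDiff ℝ 1 (fun y => u y s) := fun s => (hus s).of_le (by norm_num)
  have hρs : ∀ s, ContDiff ℝ 1 (fun y => ρ y s) := fun s =>
    hρ1.comp (g := fun p : E3 × ℝ => ρ p.1 p.2) (f := fun y : E3 => (y, s)) (by fun_prop)
  have hPs : ∀ s, ContDiff ℝ 1 (fun y => P y s) := fun s =>
    (hP.of_le (by exact_mod_cast le_top)).comp (g := fun p : E3 × ℝ => P p.1 p.2)
      (f := fun y : E3 => (y, s)) (by fun_prop)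
  have hρx : ∀ x, Differentiable ℝ (ρ x) := fun x =>
    (hρ1.comp (g := fun p : E3 × ℝ => ρ p.1 p.2) (f := fun s : ℝ => (x, s))
      (by fun_prop)).differentiable one_ne_zero
  have hux : ∀ x, Differentiable ℝ (u x) := fun x =>
    (hu1.comp (g := fun p : E3 × ℝ => u p.1 p.2) (f := fun s : ℝ => (x, s))
      (by fun_prop)).differentiable one_ne_zero
  have hu0 : ∀ s ∈ Set.Icc (0 : ℝ) T, ∀ x ∉ K, u x s = 0 := fun s hs x hx => (hsupp s hs x hx).1
  have hr0 : ∀ s ∈ Set.Icc (0 : ℝ) T, ∀ x ∉ K, ρ x s - ρbar = 0 :=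
    fun s hs x hx => (hsupp s hs x hx).2
  have hcs : ∀ s ∈ Set.Icc (0 : ℝ) T, HasCompactSupport (fun y => u y s) := fun s hs =>
    HasCompactSupport.intro hK (hu0 s hs)
  have hen1 : ContDiff ℝ 1 (fun p : E3 × ℝ => ρ p.1 p.2 * ‖u p.1 p.2‖ ^ 2) :=
    hρ1.mul (hu1.norm_sq ℝ)
  have hens : ∀ s, ContDiff ℝ 1 (fun y => ρ y s * ‖u y s‖ ^ 2) := fun s =>
    (hρs s).mul ((hus1 s).norm_sq ℝ)
  -- the time slices
  set En : ℝ → ℝ := fun s => ∫ x, ρ x s * ‖u x s‖ ^ 2 with hEn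
  set D : ℝ → ℝ := fun s => ∫ x in K, frobSq (fun y => u y s) x with hD
  set L : ℝ → ℝ := fun s => ∫ x in K, ‖u x s‖ ^ 2 with hL
  have hDc : Continuous D := continuous_parametric_integral_of_continuous (frobSq_joint hu1) hK
  have hLc : Continuous L := by
    refine continuous_parametric_integral_of_continuous (f := fun s x => ‖u x s‖ ^ 2) ?_ hK
    have h1 : Continuous (fun q : ℝ × E3 => u q.2 q.1) :=
      hu1.continuous.comp (g := fun p : E3 × ℝ => u p.1 p.2) (continuous_snd.prodMk continuous_fst)
    have h2 : Continuous (fun q : ℝ × E3 => ‖u q.2 q.1‖ ^ 2) := by fun_prop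
    exact h2
  have hfrobnn : ∀ s x, 0 ≤ frobSq (fun y => u y s) x := fun s x =>
    Finset.sum_nonneg fun i _ => by positivity
  have hD0 : ∀ s, 0 ≤ D s := fun s => integral_nonneg fun x => hfrobnn s x
  have hDfull : ∀ s ∈ Set.Icc (0 : ℝ) T, D s = ∫ x, frobSq (fun y => u y s) x := fun s hs =>
    setIntegral_eq_integral_of_forall_compl_eq_zero fun x hx => by
      have := frob_zero_off hK (hu0 s hs) x hx
      simp [frobSq, this]
  have hLfull : ∀ s ∈ Set.Icc (0 : ℝ) T, L s = ∫ x, ‖u x s‖ ^ 2 := fun s hs =>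
    setIntegral_eq_integral_of_forall_compl_eq_zero fun x hx => by simp [hu0 s hs x hx]
  have hEfull : ∀ s ∈ Set.Icc (0 : ℝ) T, ∫ x in K, ρ x s * ‖u x s‖ ^ 2 = En s := fun s hs =>
    setIntegral_eq_integral_of_forall_compl_eq_zero fun x hx => by simp [hu0 s hs x hx]
  have hE0 : ∀ s, 0 ≤ En s := fun s => integral_nonneg fun x => mul_nonneg (hρ0 x s) (by positivity)
  have h0T : (0 : ℝ) ∈ Set.Icc (0 : ℝ) T := ⟨le_rfl, hT.le⟩
  have hTT : T ∈ Set.Icc (0 : ℝ) T := ⟨hT.le, le_rfl⟩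
  -- energy identity
  have henergy : ∀ s ∈ Set.Icc (0 : ℝ) T, En s - En 0 = - (2 * ∫ τ in (0 : ℝ)..s, D τ) := by
    intro s hs
    have h := integral_time_diff (f := fun x s => ρ x s * ‖u x s‖ ^ 2) hen1 hK hs.1
    rw [hEfull s hs, hEfull 0 h0T] at h
    rw [h, ← intervalIntegral.integral_const_mul, ← intervalIntegral.integral_neg]
    refine intervalIntegral.integral_congr fun τ hτ => ?_
    rw [Set.uIcc_of_le hs.1] at hτ
    have hτ' : τ ∈ Set.Icc (0 : ℝ) T := ⟨hτ.1, hτ.2.trans hs.2⟩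
    have hpt := fun x => energy_pointwise (hρx x) (hux x)
      ((hρs τ).differentiable one_ne_zero) ((hus1 τ).differentiable one_ne_zero)
      (hmom x τ hτ') (hmass x τ hτ')
    simp only [hpt]
    rw [setIntegral_eq_integral_of_forall_compl_eq_zero (fun x hx => by simp [hu0 τ hτ' x hx])]
    have i1 := integrable_transport (hens τ) (hus1 τ) (hcs τ hτ')
    have i2 := integrable_transport (hPs τ) (hus1 τ) (hcs τ hτ')
    have i3 := integrable_inner_lap (hus τ) (hcs τ hτ')
    have i4 : Integrable (fun x => -(fderiv ℝ (fun y => ρ y τ * ‖u y τ‖ ^ 2) x) (u x τ)) := i1.neg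
    have i5 : Integrable (fun x => -(fderiv ℝ (fun y => ρ y τ * ‖u y τ‖ ^ 2) x) (u x τ)
        - 2 * (fderiv ℝ (fun y => P y τ) x) (u x τ)) := i4.sub (i2.const_mul 2)
    rw [integral_add i5 (i3.const_mul 2),
      integral_sub i4 (i2.const_mul 2), integral_neg, integral_const_mul, integral_const_mul,
      integral_transport_zero (hens τ) (hus1 τ) (hcs τ hτ') (fun x => hdiv x τ hτ'),
      integral_transport_zero (hPs τ) (hus1 τ) (hcs τ hτ') (fun x => hdiv x τ hτ'),
      integral_inner_lap (hus τ) (hcs τ hτ'), hDfull τ hτ']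
    ring
  -- conservation of the density deviation
  have hβ : ContDiff ℝ 1 (fun r : ℝ => ‖r - ρbar‖ ^ (3 / 2 : ℝ)) :=
    (contDiff_norm_rpow (E := ℝ) (p := 3 / 2) (by norm_num)).comp (contDiff_id.sub contDiff_const)
  have hcons : ∀ s ∈ Set.Icc (0 : ℝ) T, ∫ x, ‖ρ x s - ρbar‖ ^ (3 / 2 : ℝ) =
      ∫ x, ‖ρ x 0 - ρbar‖ ^ (3 / 2 : ℝ) := by
    intro s hs
    have h := integral_time_diff (f := fun x s => ‖ρ x s - ρbar‖ ^ (3 / 2 : ℝ)) (hβ.comp hρ1) hK hs.1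
    have hf : ∀ s ∈ Set.Icc (0 : ℝ) T, ∫ x in K, ‖ρ x s - ρbar‖ ^ (3 / 2 : ℝ) =
        ∫ x, ‖ρ x s - ρbar‖ ^ (3 / 2 : ℝ) := fun s hs =>
      setIntegral_eq_integral_of_forall_compl_eq_zero fun x hx => by
        rw [hr0 s hs x hx, norm_zero, Real.zero_rpow (by norm_num)]
    rw [hf s hs, hf 0 h0T] at h
    have hz : ∫ τ in (0 : ℝ)..s, ∫ x in K, deriv (fun τ => ‖ρ x τ - ρbar‖ ^ (3 / 2 : ℝ)) τ
        = ∫ τ in (0 : ℝ)..s, (0 : ℝ) := by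
      refine intervalIntegral.integral_congr fun τ hτ => ?_
      rw [Set.uIcc_of_le hs.1] at hτ
      have hτ' : τ ∈ Set.Icc (0 : ℝ) T := ⟨hτ.1, hτ.2.trans hs.2⟩
      have hpt : ∀ x, deriv (fun τ => ‖ρ x τ - ρbar‖ ^ (3 / 2 : ℝ)) τ = _ := fun x =>
        mass_pointwise (hβ.differentiable one_ne_zero) (hρx x)
          ((hρs τ).differentiable one_ne_zero) (hmass x τ hτ')
      simp only [hpt]
      rw [setIntegral_eq_integral_of_forall_compl_eq_zero (fun x hx => by simp [hu0 τ hτ' x hx]),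
        integral_neg, integral_transport_zero (φ := fun y => ‖ρ y τ - ρbar‖ ^ (3 / 2 : ℝ)) (hβ.comp (hρs τ)) (hus1 τ) (hcs τ hτ')
          (fun x => hdiv x τ hτ'), neg_zero]
    rw [hz] at h
    simp only [intervalIntegral.integral_zero] at h
    linarith
  have hσc : ∀ s, Continuous (fun x => ρ x s - ρbar) := fun s =>
    (hρs s).continuous.sub continuous_const
  have hσcs : ∀ s ∈ Set.Icc (0 : ℝ) T, HasCompactSupport (fun x => ρ x s - ρbar) := fun s hs =>
    HasCompactSupport.intro hK (hr0 s hs)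
  set a := (eLpNorm (fun x => ρ x 0 - ρbar) (ENNReal.ofReal (3 / 2)) volume).toReal with ha
  have ha' : a = (∫ x, ‖ρ x 0 - ρbar‖ ^ (3 / 2 : ℝ)) ^ (2 / 3 : ℝ) := by
    have m : MemLp (fun x => ρ x 0 - ρbar) (ENNReal.ofReal (3 / 2)) volume :=
      (hσc 0).memLp_of_hasCompactSupport (hσcs 0 h0T)
    rw [ha, m.eLpNorm_eq_integral_rpow_norm (by simp) (by simp),
      ENNReal.toReal_ofReal (by positivity), ENNReal.toReal_ofReal (by norm_num)]
    norm_num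
  have ha0 : 0 ≤ a := ENNReal.toReal_nonneg
  have hEle : ∀ s ∈ Set.Icc (0 : ℝ) T, En s ≤ En 0 := fun s hs => by
    have h1 := henergy s hs
    have h2 := intervalIntegral.integral_nonneg (μ := volume) hs.1 fun τ _ => hD0 τ
    linarith
  have hDint : ∫ τ in (0 : ℝ)..T, D τ ≤ En 0 / 2 := by
    have h1 := henergy T hTT
    have h2 := hE0 T
    linarith
  -- the L² bound on a time slice
  have hLle : ∀ s ∈ Set.Icc (0 : ℝ) T, L s ≤ ρbar⁻¹ * (En 0 + a * (C * D s)) := by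
    intro s hs
    have hS := hSob (fun x => ρ x s - ρbar) (fun y => u y s) (hσc s) (hσcs s hs) (hus1 s) (hcs s hs)
    rw [hcons s hs, ← ha', ← hDfull s hs] at hS
    have hin : ∀ {g : E3 → ℝ}, Continuous g → Integrable (fun x => g x * ‖u x s‖ ^ 2) := fun {g} hg =>
      (hg.mul ((hus1 s).continuous.norm.pow 2)).integrable_of_hasCompactSupport
        (HasCompactSupport.intro hK fun x hx => by simp [hu0 s hs x hx])
    have hmono : ∫ x, ρbar * ‖u x s‖ ^ 2 ≤
        ∫ x, (ρ x s * ‖u x s‖ ^ 2 + |ρ x s - ρbar| * ‖u x s‖ ^ 2) := by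
      refine integral_mono (hin continuous_const)
        ((hin (hρs s).continuous).add (hin (hσc s).abs)) fun x => ?_
      have := neg_abs_le (ρ x s - ρbar)
      have h2 := sq_nonneg ‖u x s‖
      simp only
      nlinarith
    rw [integral_const_mul, integral_add (hin (hρs s).continuous) (hin (hσc s).abs),
      ← hLfull s hs] at hmono
    have hE := hEle s hs
    rw [inv_mul_eq_div, le_div_iff₀ hρb]
    simp only [hEn] at hE ⊢
    linarith
  have hfin : ∫ τ in (0 : ℝ)..T, ∫ x, (‖u x τ‖ ^ 2 + frobSq (fun y => u y τ) x)
      = ∫ τ in (0 : ℝ)..T, (L τ + D τ) := by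
    refine intervalIntegral.integral_congr fun τ hτ => ?_
    rw [Set.uIcc_of_le hT.le] at hτ
    rw [integral_add _ (frobSq_integrable (hus1 τ) (hcs τ hτ)), hLfull τ hτ, hDfull τ hτ]
    exact ((hus1 τ).continuous.norm.pow 2).integrable_of_hasCompactSupport
        (HasCompactSupport.intro hK fun x hx => by simp [hu0 τ hτ x hx])
  have hbound : ∫ τ in (0 : ℝ)..T, (L τ + D τ) ≤
      ∫ τ in (0 : ℝ)..T, (ρbar⁻¹ * En 0 + (ρbar⁻¹ * (a * C) + 1) * D τ) := by
    refine intervalIntegral.integral_mono_on hT.le ((hLc.add hDc).intervalIntegrable _ _)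
      ((continuous_const.add (continuous_const.mul hDc)).intervalIntegrable _ _) fun τ hτ => ?_
    have := hLle τ hτ
    linarith
  rw [intervalIntegral.integral_add (by simp) ((hDc.intervalIntegrable _ _).const_mul _),
    intervalIntegral.integral_const, intervalIntegral.integral_const_mul] at hbound
  have hcoef : 0 ≤ ρbar⁻¹ * (a * C) + 1 := by positivity
  have h5 := mul_le_mul_of_nonneg_left hDint hcoef
  have h6 := hEle t ht
  rw [hfin]
  change En t + _ ≤ En 0 + (T * (ρbar⁻¹ * En 0) + (ρbar⁻¹ * (a * C) + 1) * (En 0 / 2))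
  simp only [smul_eq_mul, sub_zero] at hbound
  linarith
end
end
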